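/- (Maximal pattern truss decomposition.) Let G_p be a theme network with C*_p(0) ≠ ∅. Define α_0 = 0 and, for k ≥ 1 while C*_p(α_{k-1}) ≠ ∅, define α_k = min over edges e_ij ∈ E*_p(α_{k-1}) of eco_ij(C*_p(α_{k-1})), and set R_p(α_k) = E*_p(α_{k-1}) \ E*_p(α_k). Then: (1) the sequence α_0 < α_1 < α_2 < ⋯ is strictly increasing; (2) each R_p(α_k) is nonempty, so the process terminates at some finite h with C*_p(α_h) = ∅ and h ≤ |E*_p(0)|; (3) the sets R_p(α_1), …, R_p(α_h) are pairwise disjoint and their union is E*_p(0); and (4) for every α ≥ 0, E*_p(α) = ⋃_{k : α_k > α} R_p(α_k). -/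

import Mathlib

open Finset

attribute [local instance] Classical.propDecidable

variable {V S : Type*}

/-- The frequency of pattern `p` in transaction database `d`. -/
noncomputable def freqIn [DecidableEq S] (d : Multiset (Finset S)) (p : Finset S) : ℚ :=
  ((d.filter (fun t => p ⊆ t)).card : ℚ) / (d.card : ℚ)

/-- Vertex set of the theme network `G_p`: vertices with positive frequency of `p`. -/
noncomputable def themeVerts [Fintype V] [DecidableEq S]
    (db : V → Multiset (Finset S)) (p : Finset S) : Finset V :=
  univ.filter (fun v => 0 < freqIn (db v) p)

/-- Edge set of the theme network `G_p`: edges of `G` both of whose endpoints have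
positive frequency of `p`. -/
noncomputable def themeEdges [Fintype V] [DecidableEq V] [DecidableEq S]
    (G : SimpleGraph V) [DecidableRel G.Adj]
    (db : V → Multiset (Finset S)) (p : Finset S) : Finset (Sym2 V) :=
  G.edgeFinset.filter (fun e => ∀ v ∈ e, 0 < freqIn (db v) p)

/-- Vertices of the edge-induced subgraph with edge set `E'`. -/
noncomputable def edgeVerts [Fintype V] [DecidableEq V] (E' : Finset (Sym2 V)) : Finset V :=
  univ.filter (fun v => ∃ e ∈ E', v ∈ e)

/-- Edge cohesion of the edge `(i, j)` in the edge-induced subgraph with edge set `E'`,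
with vertex frequencies `f`: the sum over triangles containing the edge of the minimum
frequency of the three vertices of the triangle. -/
noncomputable def eco [Fintype V] [DecidableEq V]
    (E' : Finset (Sym2 V)) (f : V → ℚ) (i j : V) : ℚ :=
  ∑ k ∈ univ.filter (fun k => k ≠ i ∧ k ≠ j ∧ s(i, k) ∈ E' ∧ s(j, k) ∈ E'),
    min (f i) (min (f j) (f k))

/-- A pattern truss w.r.t. threshold `α`: an edge-induced subgraph of the theme network
`G_p` each of whose edges has cohesion greater than `α`. -/
def IsPatternTruss [Fintype V] [DecidableEq V] [DecidableEq S]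
    (G : SimpleGraph V) [DecidableRel G.Adj]
    (db : V → Multiset (Finset S)) (p : Finset S) (α : ℚ)
    (E' : Finset (Sym2 V)) : Prop :=
  E' ⊆ themeEdges G db p ∧
  ∀ i j : V, s(i, j) ∈ E' → α < eco E' (fun v => freqIn (db v) p) i j

/-- The (edge set of the) maximal pattern truss `C*_p(α)`: the union of all pattern
trusses with respect to `α` in `G_p`. -/
noncomputable def maxTruss [Fintype V] [DecidableEq V] [DecidableEq S]
    (G : SimpleGraph V) [DecidableRel G.Adj]
    (db : V → Multiset (Finset S)) (p : Finset S) (α : ℚ) : Finset (Sym2 V) :=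
  univ.filter (fun e => ∃ E' : Finset (Sym2 V), IsPatternTruss G db p α E' ∧ e ∈ E')

lemma freqIn_nonneg' [DecidableEq S] (d : Multiset (Finset S)) (p : Finset S) :
    0 ≤ freqIn d p := by
  unfold freqIn; positivity

lemma eco_mono' [Fintype V] [DecidableEq V] {E₁ E₂ : Finset (Sym2 V)} (h : E₁ ⊆ E₂)
    (f : V → ℚ) (hf : ∀ v, 0 ≤ f v) (i j : V) : eco E₁ f i j ≤ eco E₂ f i j := by
  unfold eco
  apply Finset.sum_le_sum_of_subset_of_nonneg
  · intro k hk
    simp only [Finset.mem_filter, Finset.mem_univ, true_and] at hk ⊢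
    exact ⟨hk.1, hk.2.1, h hk.2.2.1, h hk.2.2.2⟩
  · intro k _ _
    exact le_min (hf i) (le_min (hf j) (hf k))

lemma subset_maxTruss' [Fintype V] [DecidableEq V] [DecidableEq S]
    (G : SimpleGraph V) [DecidableRel G.Adj]
    (db : V → Multiset (Finset S)) (p : Finset S) {α : ℚ} {E' : Finset (Sym2 V)}
    (h : IsPatternTruss G db p α E') : E' ⊆ maxTruss G db p α := by
  intro e he
  unfold maxTruss
  simp only [Finset.mem_filter, Finset.mem_univ, true_and]
  exact ⟨E', h, he⟩

lemma maxTruss_isTruss' [Fintype V] [DecidableEq V] [DecidableEq S]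
    (G : SimpleGraph V) [DecidableRel G.Adj]
    (db : V → Multiset (Finset S)) (p : Finset S) (α : ℚ) :
    IsPatternTruss G db p α (maxTruss G db p α) := by
  have key : ∀ e ∈ maxTruss G db p α, ∃ E', IsPatternTruss G db p α E' ∧ e ∈ E' := by
    intro e he
    unfold maxTruss at he
    simpa only [Finset.mem_filter, Finset.mem_univ, true_and] using he
  constructor
  · intro e he
    obtain ⟨E', h, he'⟩ := key e he
    exact h.1 he'
  · intro i j he
    obtain ⟨E', h, he'⟩ := key _ he
    exact (h.2 i j he').trans_le
      (eco_mono' (subset_maxTruss' G db p h) _ (fun v => freqIn_nonneg' _ _) i j)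

lemma maxTruss_anti' [Fintype V] [DecidableEq V] [DecidableEq S]
    (G : SimpleGraph V) [DecidableRel G.Adj]
    (db : V → Multiset (Finset S)) (p : Finset S) {α β : ℚ} (h : α ≤ β) :
    maxTruss G db p β ⊆ maxTruss G db p α :=
  subset_maxTruss' G db p ⟨(maxTruss_isTruss' G db p β).1,
    fun i j he => h.trans_lt ((maxTruss_isTruss' G db p β).2 i j he)⟩

/-- Maximal pattern truss decomposition: with `α_0 = 0` and, while `C*_p(α_{k-1}) ≠ ∅`,
`α_k` the minimum edge cohesion of `C*_p(α_{k-1})` and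
`R_p(α_k) = E*_p(α_{k-1}) \ E*_p(α_k)`:
(1) the thresholds are strictly increasing; (2) each removed set is nonempty, and the
process terminates at some finite `h ≤ |E*_p(0)|` with `C*_p(α_h) = ∅`;
(3) the removed sets are pairwise disjoint with union `E*_p(0)`; and
(4) for every `α ≥ 0`, `E*_p(α) = ⋃_{k : α_k > α} R_p(α_k)`. -/
theorem maxTruss_decomposition [Fintype V] [DecidableEq V] [DecidableEq S]
    (G : SimpleGraph V) [DecidableRel G.Adj]
    (db : V → Multiset (Finset S)) (hdb : ∀ v, db v ≠ 0)
    (p : Finset S)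
    (h0 : maxTruss G db p 0 ≠ ∅)
    (A : ℕ → ℚ) (R : ℕ → Finset (Sym2 V))
    (hA0 : A 0 = 0)
    (hmin : ∀ k, maxTruss G db p (A k) ≠ ∅ →
      (∀ i j : V, s(i, j) ∈ maxTruss G db p (A k) →
        A (k + 1) ≤ eco (maxTruss G db p (A k)) (fun v => freqIn (db v) p) i j) ∧
      (∃ i j : V, s(i, j) ∈ maxTruss G db p (A k) ∧
        eco (maxTruss G db p (A k)) (fun v => freqIn (db v) p) i j = A (k + 1)))
    (hR : ∀ k, R (k + 1) = maxTruss G db p (A k) \ maxTruss G db p (A (k + 1))) :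
    (∀ k, maxTruss G db p (A k) ≠ ∅ → A k < A (k + 1)) ∧
    (∀ k, maxTruss G db p (A k) ≠ ∅ → (R (k + 1)).Nonempty) ∧
    (∃ h : ℕ, h ≤ (maxTruss G db p 0).card ∧ maxTruss G db p (A h) = ∅) ∧
    (∀ h : ℕ, (∀ k < h, maxTruss G db p (A k) ≠ ∅) → maxTruss G db p (A h) = ∅ →
      (∀ k1 k2, 1 ≤ k1 → k1 < k2 → k2 ≤ h → Disjoint (R k1) (R k2)) ∧
      ((Finset.Icc 1 h).biUnion R = maxTruss G db p 0) ∧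
      (∀ α : ℚ, 0 ≤ α →
        maxTruss G db p α = ((Finset.Icc 1 h).filter (fun k => α < A k)).biUnion R)) := by
  have h1 : ∀ k, maxTruss G db p (A k) ≠ ∅ → A k < A (k + 1) := by
    intro k hk
    obtain ⟨i, j, he, h⟩ := (hmin k hk).2
    rw [← h]
    exact (maxTruss_isTruss' G db p (A k)).2 i j he
  have h2 : ∀ k, maxTruss G db p (A k) ≠ ∅ → (R (k + 1)).Nonempty := by
    intro k hk
    obtain ⟨i, j, he, h⟩ := (hmin k hk).2
    refine ⟨s(i, j), ?_⟩
    rw [hR, Finset.mem_sdiff]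
    refine ⟨he, fun he' => ?_⟩
    have a := (maxTruss_isTruss' G db p (A (k + 1))).2 i j he'
    have b := eco_mono' (maxTruss_anti' G db p (h1 k hk).le) (fun v => freqIn (db v) p)
      (fun v => freqIn_nonneg' _ _) i j
    linarith
  refine ⟨h1, h2, ?_, ?_⟩
  · by_contra hcon
    push Not at hcon
    have hc : ∀ k, k ≤ (maxTruss G db p 0).card + 1 →
        (maxTruss G db p (A k)).card + k ≤ (maxTruss G db p 0).card := by
      intro k
      induction k with
      | zero => intro _; simp [hA0]
      | succ k ih =>
        intro hk
        have a := ih (by omega)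
        have hne : maxTruss G db p (A k) ≠ ∅ :=
          Finset.nonempty_iff_ne_empty.mp (by simpa [Finset.nonempty_iff_ne_empty] using hcon k (by omega))
        have hss := maxTruss_anti' G db p (h1 k hne).le
        have hpos := (h2 k hne).card_pos
        rw [hR] at hpos
        have := Finset.card_sdiff_add_card_eq_card hss
        omega
    have := hc _ le_rfl
    omega
  · intro h hne hemp
    have hmono : ∀ a b, a ≤ b → b ≤ h → A a ≤ A b := by
      intro a b hab
      induction b, hab using Nat.le_induction with
      | base => intro _; exact le_rfl
      | succ b hab ih =>
        intro hb
        exact (ih (by omega)).trans (h1 b (hne b (by omega))).le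
    have hfind : ∀ e ∈ maxTruss G db p 0, ∃ k, 1 ≤ k ∧ k ≤ h ∧ e ∈ R k ∧
        e ∉ maxTruss G db p (A k) := by
      intro e he
      have hex : ∃ k, e ∉ maxTruss G db p (A k) := ⟨h, by rw [hemp]; simp⟩
      have hle : Nat.find hex ≤ h := Nat.find_min' hex (by rw [hemp]; simp)
      have hspec := Nat.find_spec hex
      have hm := fun m => @Nat.find_min _ _ hex m
      generalize Nat.find hex = n at hle hspec hm
      obtain _ | n := n
      · rw [hA0] at hspec; exact absurd he hspec
      · refine ⟨n + 1, by omega, hle, ?_, hspec⟩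
        rw [hR, Finset.mem_sdiff]
        exact ⟨not_not.mp (hm n (by omega)), hspec⟩
    refine ⟨?_, ?_, ?_⟩
    · intro k1 k2 hk1 hk hk2
      obtain ⟨a, rfl⟩ : ∃ a, k1 = a + 1 := ⟨k1 - 1, by omega⟩
      obtain ⟨b, rfl⟩ : ∃ b, k2 = b + 1 := ⟨k2 - 1, by omega⟩
      rw [Finset.disjoint_left]
      intro e he1 he2
      rw [hR, Finset.mem_sdiff] at he1 he2
      exact he1.2 (maxTruss_anti' G db p (hmono (a + 1) b (by omega) (by omega)) he2.1)
    · ext e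
      rw [Finset.mem_biUnion]
      constructor
      · rintro ⟨k, hk, he⟩
        rw [Finset.mem_Icc] at hk
        obtain ⟨a, rfl⟩ : ∃ a, k = a + 1 := ⟨k - 1, by omega⟩
        rw [hR, Finset.mem_sdiff] at he
        rw [← hA0]
        exact maxTruss_anti' G db p (hmono 0 a (by omega) (by omega)) he.1
      · intro he
        obtain ⟨k, a, b, c, _⟩ := hfind e he
        exact ⟨k, Finset.mem_Icc.mpr ⟨a, b⟩, c⟩
    · intro α hα
      ext e
      rw [Finset.mem_biUnion]
      constructor
      · intro he
        obtain ⟨k, a, b, c, d⟩ := hfind e (maxTruss_anti' G db p hα he)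
        refine ⟨k, Finset.mem_filter.mpr ⟨Finset.mem_Icc.mpr ⟨a, b⟩, ?_⟩, c⟩
        by_contra hlt
        exact d (maxTruss_anti' G db p (not_lt.mp hlt) he)
      · rintro ⟨k, hk, he⟩
        rw [Finset.mem_filter, Finset.mem_Icc] at hk
        obtain ⟨⟨hk1, hk2⟩, hlt⟩ := hk
        obtain ⟨a, rfl⟩ : ∃ a, k = a + 1 := ⟨k - 1, by omega⟩
        rw [hR, Finset.mem_sdiff] at he
        refine subset_maxTruss' G db p ⟨(maxTruss_isTruss' G db p (A a)).1, ?_⟩ he.1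
        intro i j hij
        exact hlt.trans_le ((hmin a (hne a (by omega))).1 i j hij)
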